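/- Let p ∈ {3, 5, 7} be prime, let m ≥ 1 and α ≥ 1 be integers with base-p digits a_1, …, a_α of m not all zero, and let i' be the least index 1 ≤ i' ≤ α with a_{i'} ≠ 0. Then the number of indices k with 0 ≤ k ≤ α−1 such that f_p^k(m) ≡ 1 (mod p) equals #{i : i' < i ≤ α, a_i = 0} + (1 if a_{i'} = 1, else 0). In words: the number of 0s to the left of the rightmost nonzero digit among the first α base-p digits of m equals the number of integers congruent to 1 modulo p in the list m, f_p(m), f_p^2(m), …, f_p^{α−1}(m), except when the rightmost nonzero digit is 1, in which case the list contains exactly one more such integer. -/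

import Mathlib

open Finset

/-- The `i`-th base-`p` digit of `m` (indexed starting at `i = 1`),
so that `m = ∑_{i ≥ 1} (digit p m i) * p^(i-1)`. -/
def digit (p m i : ℕ) : ℕ := m / p ^ (i - 1) % p

/-- `f_p^[α](ℓ)`: the `α`-fold iterate of `f_p(ℓ) = ⌈ℓ/p⌉` applied to `ℓ`. -/
def fIter (p α ℓ : ℕ) : ℕ := (fun x => (x + (p - 1)) / p)^[α] ℓ


theorem fIter_succ_eq {p : ℕ} (hp : 0 < p) (k n : ℕ) : fIter p k (n + 1) = n / p ^ k + 1 := by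
  induction k with
  | zero => simp [fIter]
  | succ k ih =>
    unfold fIter at ih ⊢
    rw [Function.iterate_succ_apply', ih]
    have h : n / p ^ k + 1 + (p - 1) = n / p ^ k + p := by omega
    simp only [h, Nat.add_div_right _ hp, Nat.div_div_eq_div_mul, pow_succ]

theorem fIter_of_dvd {p m k : ℕ} (hp : 0 < p) (hm : 1 ≤ m) (h : p ^ k ∣ m) :
    fIter p k m = m / p ^ k := by
  obtain ⟨n, rfl⟩ := Nat.exists_eq_add_of_le' hm
  rw [fIter_succ_eq hp, Nat.succ_div, if_pos h]

theorem fIter_of_not_dvd {p m k : ℕ} (hp : 0 < p) (hm : 1 ≤ m) (h : ¬ p ^ k ∣ m) :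
    fIter p k m = m / p ^ k + 1 := by
  obtain ⟨n, rfl⟩ := Nat.exists_eq_add_of_le' hm
  rw [fIter_succ_eq hp, Nat.succ_div, if_neg h, add_zero]

theorem pow_dvd_of_digit_eq_zero {p m k : ℕ} (h : ∀ i, 1 ≤ i → i ≤ k → digit p m i = 0) :
    p ^ k ∣ m := by
  induction k with
  | zero => simp
  | succ k ih =>
    have hk : p ^ k ∣ m := ih fun i h1 h2 => h i h1 (by omega)
    have hd : p ∣ m / p ^ k := Nat.dvd_of_mod_eq_zero (h (k + 1) (by omega) le_rfl)
    rw [pow_succ]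
    exact Nat.mul_dvd_of_dvd_div hk hd

theorem digit_succ_eq_zero_of_pow_dvd {p m k : ℕ} (h : p ^ (k + 1) ∣ m) :
    digit p m (k + 1) = 0 :=
  Nat.mod_eq_zero_of_dvd (Nat.dvd_div_of_mul_dvd (by rwa [← pow_succ]))

theorem add_one_mod_eq_one_iff {p : ℕ} (hp : 2 ≤ p) (x : ℕ) : (x + 1) % p = 1 ↔ x % p = 0 := by
  have hx : x % p < p := Nat.mod_lt _ (by omega)
  rw [Nat.add_mod, Nat.mod_eq_of_lt (show 1 < p by omega)]
  rcases (show x % p + 1 < p ∨ x % p + 1 = p by omega) with h | h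
  · rw [Nat.mod_eq_of_lt h]
    omega
  · rw [h, Nat.mod_self]
    omega

/-- Lemma 6 (part for residue 1): if the first `α` base-`p` digits of `m` are not all zero
and `i'` is the least index `1 ≤ i' ≤ α` with `a_i' ≠ 0`, then the number of
`k ∈ {0, …, α−1}` with `f_p^k(m) ≡ 1 (mod p)` equals
`#{i : i' < i ≤ α, a_i = 0}`, plus one more if `a_i' = 1`. -/
theorem digit_count_lemma_1 (p : ℕ) (hp : p = 3 ∨ p = 5 ∨ p = 7) (m α : ℕ)
    (hm : 1 ≤ m) (hα : 1 ≤ α) (i' : ℕ) (hi'1 : 1 ≤ i') (hi'2 : i' ≤ α)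
    (hne : digit p m i' ≠ 0) (hmin : ∀ i, 1 ≤ i → i < i' → digit p m i = 0) :
    ((Finset.range α).filter fun k => fIter p k m % p = 1).card =
      ((Finset.Ioc i' α).filter fun i => digit p m i = 0).card +
        (if digit p m i' = 1 then 1 else 0) := by
  have hp2 : 2 ≤ p := by omega
  have hp0 : 0 < p := by omega
  obtain ⟨j, rfl⟩ := Nat.exists_eq_add_of_le' hi'1
  obtain ⟨n, rfl⟩ := Nat.exists_eq_add_of_le hi'2
  have low : ∀ k ≤ j, fIter p k m % p = digit p m (k + 1) := fun k hk => by
    rw [fIter_of_dvd hp0 hm (pow_dvd_of_digit_eq_zero fun i h1 h2 => hmin i h1 (by omega))]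
    rfl
  have high : ∀ x, fIter p (j + 1 + x) m % p = 1 ↔ digit p m (j + 2 + x) = 0 := fun x => by
    have hnd : ¬ p ^ (j + 1 + x) ∣ m := fun h =>
      hne (digit_succ_eq_zero_of_pow_dvd ((pow_dvd_pow p (by omega)).trans h))
    rw [fIter_of_not_dvd hp0 hm hnd, add_one_mod_eq_one_iff hp2, digit,
      show j + 2 + x - 1 = j + 1 + x by omega]
  have hIoc : Finset.Ioc (j + 1) (j + 1 + n) = Finset.Ico (j + 2) (j + 2 + n) := by
    ext i
    simp only [Finset.mem_Ioc, Finset.mem_Ico]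
    omega
  have hzero : ∑ k ∈ Finset.range j, (if fIter p k m % p = 1 then 1 else 0) = 0 :=
    Finset.sum_eq_zero fun k hk => by
      have hkj := Finset.mem_range.mp hk
      rw [low k hkj.le, hmin (k + 1) (by omega) (by omega), if_neg zero_ne_one]
  rw [hIoc, Finset.card_filter, Finset.card_filter, Finset.sum_range_add, Finset.sum_range_succ,
    hzero, low j le_rfl, Finset.sum_Ico_eq_sum_range, Nat.add_sub_cancel_left, zero_add, add_comm]
  simp only [high]
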